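/- arXiv:1509.09110 — 7 statements merged into one kernel-verified Lean document; each statement's English description precedes it below -/
import Mathlib

section
/- Let H be a complex Hilbert space and let (A_α) and (B_α) be nets in E(H) and A, B ∈ E(H). If ‖A_α − A‖ → 0 and ‖B_α − B‖ → 0, then ‖A_α^{1/2} B_α A_α^{1/2} − A^{1/2} B A^{1/2}‖ → 0; that is, the sequential product A ∘ B = A^{1/2} B A^{1/2} on E(H) is jointly continuous with respect to the operator norm topology. -/
set_option synthInstance.maxHeartbeats 1000000
set_option maxHeartbeats 1000000

/-- The sequential product `A ∘ B = A^{1/2} B A^{1/2}` on the set `E(H)` of quantum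
effects on a complex Hilbert space `H` is jointly continuous with respect to the
operator norm topology: if `‖A_α − A‖ → 0` and `‖B_α − B‖ → 0` for nets of effects,
then `‖A_α^{1/2} B_α A_α^{1/2} − A^{1/2} B A^{1/2}‖ → 0`. -/
theorem sequentialProduct_jointly_continuous_norm
    {H : Type*} [NormedAddCommGroup H] [InnerProductSpace ℂ H] [CompleteSpace H]
    {ι : Type*} [Preorder ι] [Nonempty ι] [IsDirected ι (· ≤ ·)] {l : Filter ι}
    (A B : ι → H →L[ℂ] H) (A₀ B₀ : H →L[ℂ] H)
    (hA : ∀ α, 0 ≤ A α ∧ A α ≤ 1) (hB : ∀ α, 0 ≤ B α ∧ B α ≤ 1)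
    (hA₀ : 0 ≤ A₀ ∧ A₀ ≤ 1) (hB₀ : 0 ≤ B₀ ∧ B₀ ≤ 1)
    (hAconv : Filter.Tendsto (fun α => ‖A α - A₀‖) l (nhds 0))
    (hBconv : Filter.Tendsto (fun α => ‖B α - B₀‖) l (nhds 0)) :
    Filter.Tendsto
      (fun α => ‖CFC.sqrt (A α) * B α * CFC.sqrt (A α) - CFC.sqrt A₀ * B₀ * CFC.sqrt A₀‖)
      l (nhds 0) := by
  rw [← tendsto_iff_norm_sub_tendsto_zero] at hAconv hBconv ⊢
  have hsqrt : Filter.Tendsto (fun α => CFC.sqrt (A α)) l (nhds (CFC.sqrt A₀)) :=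
    (CFC.continuousOn_sqrt A₀ hA₀.1).tendsto.comp
      (tendsto_nhdsWithin_iff.2 ⟨hAconv, .of_forall fun α => (hA α).1⟩)
  exact (hsqrt.mul hBconv).mul hsqrt
end

section
/- There exist a complex separable Hilbert space H, a sequence (P_n) of orthogonal projections on H, an effect P_0 ∈ E(H), and an effect B ∈ E(H) such that P_n → P_0 in the weak operator topology, P_n^{1/2} B P_n^{1/2} → (1/4) P_0 in the weak operator topology, while P_0^{1/2} B P_0^{1/2} = (1/2) P_0 ≠ (1/4) P_0. In particular, the sequential product A ∘ B = A^{1/2} B A^{1/2} on E(H) is not continuous in its first variable with respect to the weak operator topology. -/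
set_option synthInstance.maxHeartbeats 1000000
set_option maxHeartbeats 1000000

open scoped InnerProductSpace

open InnerProductSpace Filter

/-- The inner products of a vector with an orthonormal sequence tend to zero. -/
lemma Orthonormal.tendsto_inner_zero {H : Type*} [NormedAddCommGroup H] [InnerProductSpace ℂ H]
    {e : ℕ → H} (he : Orthonormal ℂ e) (x : H) :
    Tendsto (fun n => ⟪e n, x⟫_ℂ) atTop (nhds 0) := by
  have h := (he.inner_products_summable (x := x)).tendsto_atTop_zero.sqrt
  rw [tendsto_zero_iff_norm_tendsto_zero]
  simpa [Real.sqrt_sq] using h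

/-- A nonnegative real multiple of a rank-one operator `|x⟩⟨x|` is nonnegative. -/
lemma smul_rankOne_self_nonneg {H : Type*} [NormedAddCommGroup H] [InnerProductSpace ℂ H]
    [CompleteSpace H] {c : ℝ} (hc : 0 ≤ c) (x : H) : 0 ≤ (c : ℂ) • rankOne ℂ x x := by
  rw [ContinuousLinearMap.nonneg_iff_isPositive]
  exact (isPositive_rankOne_self x).smul_of_nonneg (by exact_mod_cast hc)

/-- For an orthonormal sequence `e`, the projections onto the lines spanned by `e 0 + e (n + 1)`
converge weakly to half of the projection onto `e 0`, and sandwiching that limit separates the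
weak limit of the sequential products from the sequential product of the weak limit. -/
lemma Orthonormal.exists_sequentialProduct_discontinuity {H : Type*} [NormedAddCommGroup H]
    [InnerProductSpace ℂ H] [CompleteSpace H] {e : ℕ → H} (he : Orthonormal ℂ e) :
    ∃ (P : ℕ → H →L[ℂ] H) (P₀ B : H →L[ℂ] H),
      (∀ n, IsSelfAdjoint (P n) ∧ IsIdempotentElem (P n)) ∧
      (0 ≤ P₀ ∧ P₀ ≤ 1) ∧ (0 ≤ B ∧ B ≤ 1) ∧
      (∀ x y : H, Tendsto (fun n => ⟪(P n) x, y⟫_ℂ) atTop (nhds ⟪P₀ x, y⟫_ℂ)) ∧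
      (∀ x y : H, Tendsto (fun n => ⟪(CFC.sqrt (P n) * B * CFC.sqrt (P n)) x, y⟫_ℂ)
        atTop (nhds ⟪((1/4 : ℂ) • P₀) x, y⟫_ℂ)) ∧
      CFC.sqrt P₀ * B * CFC.sqrt P₀ = (1/2 : ℂ) • P₀ ∧
      (1/2 : ℂ) • P₀ ≠ (1/4 : ℂ) • P₀ := by
  obtain ⟨c, hc0, hc⟩ : ∃ c : ℝ, 0 ≤ c ∧ c * c = 1 / 2 :=
    ⟨√(1 / 2), Real.sqrt_nonneg _, Real.mul_self_sqrt (by norm_num)⟩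
  have hc' : (c : ℂ) * c = 1 / 2 := by rw [← Complex.ofReal_mul, hc]; norm_num
  set E : H →L[ℂ] H := rankOne ℂ (e 0) (e 0) with hE
  set v : ℕ → H := fun n => (c : ℂ) • (e 0 + e (n + 1)) with hv
  have hEp : IsStarProjection E := isStarProjection_rankOne_self (he.1 0)
  have hEE : E * E = E := hEp.isIdempotentElem
  have h00 (n) : ⟪e n, e n⟫_ℂ = 1 := by simp [inner_self_eq_norm_sq_to_K, he.1 n]
  have h0 (n) : ⟪e 0, e (n + 1)⟫_ℂ = 0 := he.2 (by simp)
  have h1 (n) : ⟪e (n + 1), e 0⟫_ℂ = 0 := he.2 (by simp)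
  have hvv (n) : ⟪v n, v n⟫_ℂ = 1 := by
    simp only [hv, inner_smul_left, inner_smul_right, inner_add_left, inner_add_right, h00, h0, h1,
      Complex.conj_ofReal]
    linear_combination 2 * hc'
  have hvn (n) : ‖v n‖ = 1 := by
    have h := inner_self_eq_norm_sq_to_K (𝕜 := ℂ) (v n)
    rw [hvv] at h
    have h' : ‖v n‖ ^ 2 = 1 := Complex.ofReal_injective (by simpa using h.symm)
    exact (pow_eq_one_iff_of_nonneg (norm_nonneg _) two_ne_zero).mp h'
  have hP (n) : IsStarProjection (rankOne ℂ (v n) (v n)) := isStarProjection_rankOne_self (hvn n)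
  have hsP (n) : CFC.sqrt (rankOne ℂ (v n) (v n)) = rankOne ℂ (v n) (v n) :=
    CFC.sqrt_unique (hP n).isIdempotentElem (hP n).nonneg
  have hB0 : 0 ≤ (1 / 2 : ℂ) • E := by
    simpa using smul_rankOne_self_nonneg (c := 1 / 2) (by norm_num) (e 0)
  have hB1 : (1 / 2 : ℂ) • E ≤ 1 := by
    refine le_trans (le_add_of_nonneg_right hB0) ?_
    rw [← add_smul]
    norm_num
    exact hEp.le_one
  have hsB : CFC.sqrt ((1 / 2 : ℂ) • E) = (c : ℂ) • E := by
    refine CFC.sqrt_unique ?_ (smul_rankOne_self_nonneg hc0 _)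
    rw [smul_mul_smul_comm, hc', hEE]
  have hlim (x y : H) : Tendsto (fun n => ⟪rankOne ℂ (v n) (v n) x, y⟫_ℂ) atTop
      (nhds ⟪((1 / 2 : ℂ) • E) x, y⟫_ℂ) := by
    have hy := ((tendsto_add_atTop_iff_nat 1).mpr (he.tendsto_inner_zero y)).const_add ⟪e 0, y⟫_ℂ
    have hx := ((tendsto_add_atTop_iff_nat 1).mpr (he.tendsto_inner_zero x)).const_add ⟪e 0, x⟫_ℂ
    have hx' := (Complex.continuous_conj.tendsto _).comp hx
    convert (hx'.mul hy).const_mul (1 / 2 : ℂ) using 2 with n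
    · simp only [hv, inner_left_rankOne_apply, inner_smul_left, inner_smul_right, inner_add_left,
        inner_add_right, Complex.conj_ofReal, Function.comp, map_add, inner_conj_symm, ← hc']
      ring
    · simp only [hE, smul_apply, inner_left_rankOne_apply, inner_smul_left, add_zero,
        inner_conj_symm, map_div₀, map_one, map_ofNat]
  have hsand (n) : rankOne ℂ (v n) (v n) * ((1 / 2 : ℂ) • E) * rankOne ℂ (v n) (v n) =
      (1 / 4 : ℂ) • rankOne ℂ (v n) (v n) := by
    ext x
    have ha : ⟪e 0, v n⟫_ℂ = c := by simp only [hv, inner_smul_right, inner_add_right, h00, h0, add_zero, mul_one]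
    have hb : ⟪v n, e 0⟫_ℂ = c := by
      simp only [hv, inner_smul_left, inner_add_left, h00, h1, Complex.conj_ofReal, add_zero, mul_one]
    simp only [hE, mul_apply_eq_comp, smul_apply, rankOne_apply,
      inner_smul_right, smul_smul, ha, hb]
    congr 1
    linear_combination (1 / 2 * ⟪v n, x⟫_ℂ) * hc'
  refine ⟨fun n => rankOne ℂ (v n) (v n), (1 / 2 : ℂ) • E, (1 / 2 : ℂ) • E,
    fun n => ⟨(hP n).isSelfAdjoint, (hP n).isIdempotentElem⟩, ⟨hB0, hB1⟩, ⟨hB0, hB1⟩, hlim,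
    fun x y => ?_, ?_, fun h => ?_⟩
  · simp only [hsP, hsand]
    have h := (hlim x y).const_mul (starRingEnd ℂ (1 / 4))
    simp only [← inner_smul_left, ← smul_apply] at h
    exact h
  · rw [hsB, smul_mul_smul_comm, hEE, smul_mul_smul_comm, hEE, smul_smul]
    congr 1
    linear_combination (1 / 2) * hc'
  · have h' := congrArg (fun T : H →L[ℂ] H => ⟪e 0, T (e 0)⟫_ℂ) h
    simp only [hE, smul_apply, rankOne_apply, inner_smul_right, h00] at h'
    norm_num at h'

/-- There exist a complex separable Hilbert space `H`, a sequence `(P_n)` of orthogonal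
projections on `H`, an effect `P₀` and an effect `B` such that `P_n → P₀` in the weak
operator topology, `P_n^{1/2} B P_n^{1/2} → (1/4) P₀` in the weak operator topology,
while `P₀^{1/2} B P₀^{1/2} = (1/2) P₀ ≠ (1/4) P₀`.  Hence the sequential product
`A ∘ B = A^{1/2} B A^{1/2}` is not continuous in its first variable with respect to
the weak operator topology. -/
theorem sequentialProduct_not_continuous_first_var_WOT :
    ∃ (H : Type) (_ : NormedAddCommGroup H) (_ : InnerProductSpace ℂ H)
      (_ : CompleteSpace H) (_ : TopologicalSpace.SeparableSpace H)
      (P : ℕ → H →L[ℂ] H) (P₀ B : H →L[ℂ] H),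
      (∀ n, IsSelfAdjoint (P n) ∧ IsIdempotentElem (P n)) ∧
      (0 ≤ P₀ ∧ P₀ ≤ 1) ∧ (0 ≤ B ∧ B ≤ 1) ∧
      (∀ x y : H, Filter.Tendsto (fun n => ⟪(P n) x, y⟫_ℂ) Filter.atTop
        (nhds ⟪P₀ x, y⟫_ℂ)) ∧
      (∀ x y : H, Filter.Tendsto (fun n => ⟪(CFC.sqrt (P n) * B * CFC.sqrt (P n)) x, y⟫_ℂ)
        Filter.atTop (nhds ⟪((1/4 : ℂ) • P₀) x, y⟫_ℂ)) ∧
      CFC.sqrt P₀ * B * CFC.sqrt P₀ = (1/2 : ℂ) • P₀ ∧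
      (1/2 : ℂ) • P₀ ≠ (1/4 : ℂ) • P₀ := by
  have : Fact ((0 : ℝ) < 1) := ⟨one_pos⟩
  have : Fact ((2 : ENNReal) ≠ ⊤) := ⟨by norm_num⟩
  have he : Orthonormal ℂ fun n : ℕ => @fourierLp 1 _ 2 _ (n : ℤ) :=
    orthonormal_fourier.comp _ Nat.cast_injective
  exact ⟨MeasureTheory.Lp ℂ 2 (AddCircle.haarAddCircle (T := 1)), inferInstance, inferInstance,
    inferInstance, inferInstance, he.exists_sequentialProduct_discontinuity⟩
end

section
/- Let H be a complex Hilbert space, A ∈ E(H), and let (B_α) be a net in E(H) that order-converges to B ∈ E(H), i.e. there exist nets (C_α) and (D_α) in E(H) with (C_α) increasing with supremum B, (D_α) decreasing with infimum B, and C_α ≤ B_α ≤ D_α for all α. Then (A^{1/2} B_α A^{1/2}) order-converges to A^{1/2} B A^{1/2}: the net (A^{1/2} C_α A^{1/2}) is increasing with supremum A^{1/2} B A^{1/2}, the net (A^{1/2} D_α A^{1/2}) is decreasing with infimum A^{1/2} B A^{1/2}, and A^{1/2} C_α A^{1/2} ≤ A^{1/2} B_α A^{1/2} ≤ A^{1/2}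 D_α A^{1/2} for all α. -/
set_option synthInstance.maxHeartbeats 1000000
set_option maxHeartbeats 1000000

section ConjugateLUB

variable {𝓐 : Type*} [CStarAlgebra 𝓐] [PartialOrder 𝓐] [StarOrderedRing 𝓐]

/-- Conjugation by a self-adjoint unit is an order automorphism, hence preserves suprema. -/
lemma IsLUB.conjugate_of_isUnit {ι : Type*} {f : ι → 𝓐} {b u : 𝓐}
    (hf : IsLUB (Set.range f) b) (hu : IsUnit u) (hsa : IsSelfAdjoint u) :
    IsLUB (Set.range fun i => u * f i * u) (u * b * u) := by
  obtain ⟨u, rfl⟩ := hu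
  have hinv : IsSelfAdjoint (↑u⁻¹ : 𝓐) := by
    have h : star u = u := Units.ext hsa
    rw [IsSelfAdjoint, ← Units.coe_star, star_inv, h]
  refine ⟨?_, fun t ht => ?_⟩
  · rintro _ ⟨i, rfl⟩
    exact hsa.conjugate_le_conjugate (hf.1 ⟨i, rfl⟩)
  · have key : b ≤ ↑u⁻¹ * t * ↑u⁻¹ := hf.2 <| by
      rintro _ ⟨i, rfl⟩
      simpa [mul_assoc] using hinv.conjugate_le_conjugate (ht ⟨i, rfl⟩)
    simpa [mul_assoc] using hsa.conjugate_le_conjugate key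

/-- Perturbing the conjugating element by a scalar `ε` changes the conjugate of `c` by a
self-adjoint element of norm `O(ε)`. -/
lemma conjugate_add_smul_one_le {s c : 𝓐} {r ε : ℝ} (hs : IsSelfAdjoint s)
    (hc : IsSelfAdjoint c) (hcr : ‖c‖ ≤ r) (hε : 0 ≤ ε) :
    (s + ε • 1) * c * (s + ε • 1) ≤
      s * c * s + algebraMap ℝ 𝓐 (ε * (‖s‖ * r + r * ‖s‖) + ε * (ε * r)) := by
  have hsa : IsSelfAdjoint (ε • (s * c + c * s) + ε • (ε • c)) := by
    simp [isSelfAdjoint_iff, hs.star_eq, hc.star_eq, add_comm]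
  have hr : 0 ≤ r := (norm_nonneg c).trans hcr
  have hnorm : ‖ε • (s * c + c * s) + ε • (ε • c)‖ ≤
      ε * (‖s‖ * r + r * ‖s‖) + ε * (ε * r) := by
    refine (norm_add_le _ _).trans ?_
    simp only [norm_smul, Real.norm_of_nonneg hε]
    gcongr
    refine (norm_add_le _ _).trans (add_le_add ?_ ?_)
    · exact (norm_mul_le _ _).trans (by gcongr)
    · exact (norm_mul_le _ _).trans (by gcongr)
  have hexp : (s + ε • 1) * c * (s + ε • 1) =
      s * c * s + (ε • (s * c + c * s) + ε • (ε • c)) := by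
    simp only [add_mul, mul_add, smul_mul_assoc, mul_smul_comm, one_mul, mul_one, smul_add]
    abel
  rw [hexp]
  exact add_le_add_right (hsa.le_algebraMap_norm_self.trans (algebraMap_mono 𝓐 hnorm)) _

/-- Conjugation by a positive element preserves suprema of norm-bounded families of self-adjoint
elements of a C⋆-algebra. -/
lemma IsLUB.conjugate_of_nonneg {ι : Type*} {f : ι → 𝓐} {b s : 𝓐} {r : ℝ}
    (hf : IsLUB (Set.range f) b) (hsa : ∀ i, IsSelfAdjoint (f i)) (hr : ∀ i, ‖f i‖ ≤ r)
    (hs : 0 ≤ s) :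
    IsLUB (Set.range fun i => s * f i * s) (s * b * s) := by
  refine ⟨?_, fun t ht => ?_⟩
  · rintro _ ⟨i, rfl⟩
    exact conjugate_le_conjugate_of_nonneg (hf.1 ⟨i, rfl⟩) hs
  have key (ε : ℝ) (hε : 0 < ε) : (s + ε • 1) * b * (s + ε • 1) ≤
      t + algebraMap ℝ 𝓐 (ε * (‖s‖ * r + r * ‖s‖) + ε * (ε * r)) := by
    have hε1 : IsStrictlyPositive (ε • (1 : 𝓐)) := isStrictlyPositive_one.smul hε
    have hu : IsStrictlyPositive (s + ε • (1 : 𝓐)) := .nonneg_add hs hε1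
    refine (hf.conjugate_of_isUnit hu.isUnit hu.isSelfAdjoint).2 ?_
    rintro _ ⟨i, rfl⟩
    exact (conjugate_add_smul_one_le (.of_nonneg hs) (hsa i) (hr i) hε.le).trans
      (add_le_add_left (ht ⟨i, rfl⟩) _)
  have hl : Filter.Tendsto (fun ε : ℝ => (s + ε • 1) * b * (s + ε • 1))
      (nhdsWithin 0 (Set.Ioi 0)) (nhds (s * b * s)) := by
    have hcont : Continuous fun ε : ℝ => (s + ε • 1) * b * (s + ε • 1) := by fun_prop
    simpa using (hcont.tendsto 0).mono_left nhdsWithin_le_nhds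
  have hrt : Filter.Tendsto
      (fun ε : ℝ => t + algebraMap ℝ 𝓐 (ε * (‖s‖ * r + r * ‖s‖) + ε * (ε * r)))
      (nhdsWithin 0 (Set.Ioi 0)) (nhds t) := by
    have hcont : Continuous
        fun ε : ℝ => t + algebraMap ℝ 𝓐 (ε * (‖s‖ * r + r * ‖s‖) + ε * (ε * r)) := by
      fun_prop
    simpa using (hcont.tendsto 0).mono_left nhdsWithin_le_nhds
  exact le_of_tendsto_of_tendsto hl hrt (eventually_mem_nhdsWithin.mono key)

/-- Conjugation by a positive element preserves infima of norm-bounded families of self-adjoint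
elements of a C⋆-algebra. -/
lemma IsGLB.conjugate_of_nonneg {ι : Type*} {f : ι → 𝓐} {b s : 𝓐} {r : ℝ}
    (hf : IsGLB (Set.range f) b) (hsa : ∀ i, IsSelfAdjoint (f i)) (hr : ∀ i, ‖f i‖ ≤ r)
    (hs : 0 ≤ s) :
    IsGLB (Set.range fun i => s * f i * s) (s * b * s) := by
  have hneg (g : ι → 𝓐) : -Set.range g = Set.range fun i => -g i := by
    rw [← Set.image_neg_eq_neg, ← Set.range_comp]; rfl
  have h : IsLUB (Set.range fun i => -f i) (-b) := by
    simpa [← hneg] using hf.neg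
  have h' := h.conjugate_of_nonneg (fun i => (hsa i).neg) (fun i => by simpa using hr i) hs
  simpa [hneg] using h'.neg

end ConjugateLUB

/-- The sequential product on the quantum effects of a complex Hilbert space `H` is
continuous in its second variable with respect to order convergence: if `C_α ↑ B`,
`D_α ↓ B` and `C_α ≤ B_α ≤ D_α` (all effects), then `A^{1/2} C_α A^{1/2}` is increasing
with supremum `A^{1/2} B A^{1/2}`, `A^{1/2} D_α A^{1/2}` is decreasing with infimum
`A^{1/2} B A^{1/2}`, and `A^{1/2} C_α A^{1/2} ≤ A^{1/2} B_α A^{1/2} ≤ A^{1/2} D_α A^{1/2}`,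
so that `A^{1/2} B_α A^{1/2}` order-converges to `A^{1/2} B A^{1/2}`. -/
theorem sequentialProduct_orderConvergence_second_var
    {H : Type*} [NormedAddCommGroup H] [InnerProductSpace ℂ H] [CompleteSpace H]
    {ι : Type*} [Preorder ι] [Nonempty ι] [IsDirected ι (· ≤ ·)]
    (A : H →L[ℂ] H) (B C D : ι → H →L[ℂ] H) (B₀ : H →L[ℂ] H)
    (hA : 0 ≤ A ∧ A ≤ 1) (hB : ∀ α, 0 ≤ B α ∧ B α ≤ 1)
    (hC : ∀ α, 0 ≤ C α ∧ C α ≤ 1) (hD : ∀ α, 0 ≤ D α ∧ D α ≤ 1)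
    (hB₀ : 0 ≤ B₀ ∧ B₀ ≤ 1)
    (hCmono : Monotone C) (hCsup : IsLUB (Set.range C) B₀)
    (hDanti : Antitone D) (hDinf : IsGLB (Set.range D) B₀)
    (hsq : ∀ α, C α ≤ B α ∧ B α ≤ D α) :
    (Monotone (fun α => CFC.sqrt A * C α * CFC.sqrt A) ∧
      IsLUB (Set.range fun α => CFC.sqrt A * C α * CFC.sqrt A)
        (CFC.sqrt A * B₀ * CFC.sqrt A)) ∧
    (Antitone (fun α => CFC.sqrt A * D α * CFC.sqrt A) ∧
      IsGLB (Set.range fun α => CFC.sqrt A * D α * CFC.sqrt A)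
        (CFC.sqrt A * B₀ * CFC.sqrt A)) ∧
    (∀ α, CFC.sqrt A * C α * CFC.sqrt A ≤ CFC.sqrt A * B α * CFC.sqrt A ∧
        CFC.sqrt A * B α * CFC.sqrt A ≤ CFC.sqrt A * D α * CFC.sqrt A) := by
  have hS : 0 ≤ CFC.sqrt A := CFC.sqrt_nonneg A
  have hnorm {T : H →L[ℂ] H} (hT : 0 ≤ T ∧ T ≤ 1) : ‖T‖ ≤ 1 :=
    (CStarAlgebra.norm_le_one_iff_of_nonneg T hT.1).2 hT.2
  refine ⟨⟨fun i j hij => conjugate_le_conjugate_of_nonneg (hCmono hij) hS, ?_⟩,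
    ⟨fun i j hij => conjugate_le_conjugate_of_nonneg (hDanti hij) hS, ?_⟩,
    fun i => ⟨conjugate_le_conjugate_of_nonneg (hsq i).1 hS,
      conjugate_le_conjugate_of_nonneg (hsq i).2 hS⟩⟩
  · exact hCsup.conjugate_of_nonneg (fun i => .of_nonneg (hC i).1) (fun i => hnorm (hC i)) hS
  · exact hDinf.conjugate_of_nonneg (fun i => .of_nonneg (hD i).1) (fun i => hnorm (hD i)) hS
end

section
/- Let H be a complex Hilbert space and A, B ∈ E(H). Then A^{1/2} B + B A^{1/2} ≤ 2I in the Loewner order. -/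
set_option synthInstance.maxHeartbeats 1000000
set_option maxHeartbeats 1000000

/-- The square of an element between `0` and `1` is at most `1`. -/
theorem mul_self_le_one_of_nonneg_of_le_one {R : Type*} [Ring R] [StarRing R] [PartialOrder R]
    [StarOrderedRing R] {b : R} (h0 : 0 ≤ b) (h1 : b ≤ 1) : b * b ≤ 1 := by
  have hb : IsSelfAdjoint b := .of_nonneg h0
  have h1' : 0 ≤ 1 - b := sub_nonneg.2 h1
  have h := add_nonneg (hb.conjugate_nonneg h1')
    ((IsSelfAdjoint.of_nonneg h1').conjugate_nonneg h0)
  have hle : b * b ≤ b := by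
    rw [← sub_nonneg]
    convert h using 1
    noncomm_ring
  exact hle.trans h1

/-- Arithmetic-mean inequality for self-adjoint, possibly noncommuting, elements. -/
theorem IsSelfAdjoint.mul_add_mul_le_mul_self_add_mul_self {R : Type*} [Ring R] [StarRing R]
    [PartialOrder R] [StarOrderedRing R] {a b : R} (ha : IsSelfAdjoint a)
    (hb : IsSelfAdjoint b) : a * b + b * a ≤ a * a + b * b := by
  rw [← sub_nonneg]
  convert (ha.sub hb).mul_self_nonneg using 1
  noncomm_ring

/-- For effects `A, B` on a complex Hilbert space `H`,
`A^{1/2} B + B A^{1/2} ≤ 2I` in the Loewner order. -/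
theorem sqrt_mul_add_mul_sqrt_le_two
    {H : Type*} [NormedAddCommGroup H] [InnerProductSpace ℂ H] [CompleteSpace H]
    (A B : H →L[ℂ] H) (hA : 0 ≤ A ∧ A ≤ 1) (hB : 0 ≤ B ∧ B ≤ 1) :
    CFC.sqrt A * B + B * CFC.sqrt A ≤ (2 : H →L[ℂ] H) := by
  have hS : IsSelfAdjoint (CFC.sqrt A) := .of_nonneg (CFC.sqrt_nonneg A)
  calc CFC.sqrt A * B + B * CFC.sqrt A
      ≤ CFC.sqrt A * CFC.sqrt A + B * B :=
        hS.mul_add_mul_le_mul_self_add_mul_self (.of_nonneg hB.1)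
    _ ≤ 1 + 1 := by
        rw [CFC.sqrt_mul_sqrt_self A hA.1]
        exact add_le_add hA.2 (mul_self_le_one_of_nonneg_of_le_one hB.1 hB.2)
    _ = 2 := one_add_one_eq_two
end

section
/- Let H be a complex Hilbert space and A, B, C ∈ E(H). If C ≤ (λI + A)^{1/2} B (λI + A)^{1/2} for every λ > 0, then C ≤ A^{1/2} B A^{1/2}. -/
set_option synthInstance.maxHeartbeats 1000000
set_option maxHeartbeats 1000000

/-- For effects `A, B, C` on a complex Hilbert space `H`: if
`C ≤ (λI + A)^{1/2} B (λI + A)^{1/2}` for every `λ > 0`, then `C ≤ A^{1/2} B A^{1/2}`. -/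
theorem le_sqrt_mul_sqrt_of_forall_lam
    {H : Type*} [NormedAddCommGroup H] [InnerProductSpace ℂ H] [CompleteSpace H]
    (A B C : H →L[ℂ] H) (hA : 0 ≤ A ∧ A ≤ 1) (hB : 0 ≤ B ∧ B ≤ 1) (hC : 0 ≤ C ∧ C ≤ 1)
    (h : ∀ lam : ℝ, 0 < lam →
      C ≤ CFC.sqrt (lam • (1 : H →L[ℂ] H) + A) * B * CFC.sqrt (lam • (1 : H →L[ℂ] H) + A)) :
    C ≤ CFC.sqrt A * B * CFC.sqrt A := by
  have hshift : Filter.Tendsto (fun lam : ℝ => lam • (1 : H →L[ℂ] H) + A)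
      (nhdsWithin 0 (Set.Ioi 0)) (nhdsWithin A {a | 0 ≤ a}) := by
    refine tendsto_nhdsWithin_iff.mpr ⟨?_, ?_⟩
    · have hcont : Continuous fun lam : ℝ => lam • (1 : H →L[ℂ] H) + A := by fun_prop
      simpa using (hcont.tendsto 0).mono_left nhdsWithin_le_nhds
    · filter_upwards [self_mem_nhdsWithin] with lam hlam
      exact add_nonneg (smul_nonneg (le_of_lt hlam) zero_le_one) hA.1
  have hsqrt := (CFC.continuousOn_sqrt A hA.1).tendsto.comp hshift
  refine ge_of_tendsto ((hsqrt.mul_const B).mul hsqrt) ?_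
  filter_upwards [self_mem_nhdsWithin] with lam hlam using h lam hlam
end

section
/- Let H be a complex Hilbert space, A, B, C ∈ E(H), and λ > 0. If A^{1/2} B A^{1/2} ≤ C, then (λI + A)^{1/2} B (λI + A)^{1/2} ≤ (λ + 2√λ) I + C. -/
set_option synthInstance.maxHeartbeats 1000000
set_option maxHeartbeats 1000000

/-- The square root of a shift `r + a` of a positive operator, as a continuous function of `a`. -/
theorem CFC.sqrt_smul_one_add_eq_cfc {R : Type*} [CStarAlgebra R] [PartialOrder R]
    [StarOrderedRing R] {a : R} (ha : 0 ≤ a) {r : ℝ} (hr : 0 ≤ r) :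
    CFC.sqrt (r • (1 : R) + a) = cfc (fun x : ℝ => Real.sqrt (r + x)) a := by
  have hsa : IsSelfAdjoint a := IsSelfAdjoint.of_nonneg ha
  refine CFC.sqrt_unique ?_ (cfc_nonneg fun x _ => Real.sqrt_nonneg _)
  rw [← cfc_mul (fun x : ℝ => Real.sqrt (r + x)) (fun x : ℝ => Real.sqrt (r + x)) a
    (by fun_prop) (by fun_prop)]
  rw [cfc_congr (g := fun x : ℝ => r + x) fun x hx =>
    Real.mul_self_sqrt (add_nonneg hr (spectrum_nonneg_of_nonneg ha hx))]
  rw [cfc_const_add r (fun x : ℝ => x) a, cfc_id' ℝ a, Algebra.algebraMap_eq_smul_one]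

theorem CFC.norm_sqrt_smul_one_add_sub_sqrt_le {R : Type*} [CStarAlgebra R] [PartialOrder R]
    [StarOrderedRing R] {a : R} (ha : 0 ≤ a) {r : ℝ} (hr : 0 ≤ r) :
    ‖CFC.sqrt (r • (1 : R) + a) - CFC.sqrt a‖ ≤ Real.sqrt r := by
  have hsqrt : CFC.sqrt a = cfc (fun x : ℝ => Real.sqrt x) a := by
    simpa using CFC.sqrt_smul_one_add_eq_cfc ha le_rfl
  rw [CFC.sqrt_smul_one_add_eq_cfc ha hr, hsqrt,
    ← cfc_sub (fun x : ℝ => Real.sqrt (r + x)) (fun x : ℝ => Real.sqrt x) a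
      (by fun_prop) (by fun_prop)]
  refine norm_cfc_le (Real.sqrt_nonneg r) fun x hx => ?_
  have hx0 : 0 ≤ x := spectrum_nonneg_of_nonneg ha hx
  rw [Real.norm_eq_abs, _root_.abs_of_nonneg (sub_nonneg.2 (Real.sqrt_le_sqrt (by linarith)))]
  rw [sub_le_iff_le_add, Real.sqrt_le_left (by positivity)]
  nlinarith [Real.sq_sqrt hr, Real.sq_sqrt hx0,
    mul_nonneg (Real.sqrt_nonneg r) (Real.sqrt_nonneg x)]

theorem CFC.norm_sqrt_le_one {R : Type*} [CStarAlgebra R] [PartialOrder R]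
    [StarOrderedRing R] {a : R} (ha : 0 ≤ a) (ha1 : ‖a‖ ≤ 1) : ‖CFC.sqrt a‖ ≤ 1 := by
  have h := CStarRing.norm_star_mul_self (x := CFC.sqrt a)
  rw [(IsSelfAdjoint.of_nonneg (CFC.sqrt_nonneg a)).star_eq, CFC.sqrt_mul_sqrt_self a ha] at h
  nlinarith [norm_nonneg (CFC.sqrt a)]

theorem norm_mul_mul_sub_mul_mul_le {R : Type*} [NormedRing R] {s t b : R} {d : ℝ}
    (ht : ‖t‖ ≤ 1) (hb : ‖b‖ ≤ 1) (hd : ‖s - t‖ ≤ d) :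
    ‖s * b * s - t * b * t‖ ≤ d ^ 2 + 2 * d := by
  have hd0 : 0 ≤ d := (norm_nonneg _).trans hd
  have hsplit : s * b * s - t * b * t =
      (s - t) * b * (s - t) + (s - t) * b * t + t * b * (s - t) := by noncomm_ring
  have hbound {x y : R} {p q : ℝ} (hp : 0 ≤ p) (hx : ‖x‖ ≤ p) (hy : ‖y‖ ≤ q) :
      ‖x * b * y‖ ≤ p * q := by
    calc ‖x * b * y‖ ≤ ‖x‖ * ‖b‖ * ‖y‖ := norm_mul₃_le
      _ ≤ p * 1 * q := by gcongr
      _ = p * q := by ring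
  rw [hsplit]
  calc _ ≤ d * d + d * 1 + 1 * d :=
        norm_add₃_le.trans (add_le_add_three (hbound hd0 hd hd) (hbound hd0 hd ht)
          (hbound zero_le_one ht hd))
    _ = d ^ 2 + 2 * d := by ring

theorem CFC.sqrt_mul_sqrt_perturb_le {R : Type*} [CStarAlgebra R] [PartialOrder R]
    [StarOrderedRing R] {a b c : R} (ha : 0 ≤ a) (ha1 : ‖a‖ ≤ 1) (hb : IsSelfAdjoint b)
    (hb1 : ‖b‖ ≤ 1) {r : ℝ} (hr : 0 ≤ r) (h : CFC.sqrt a * b * CFC.sqrt a ≤ c) :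
    CFC.sqrt (r • (1 : R) + a) * b * CFC.sqrt (r • (1 : R) + a) ≤
      (r + 2 * Real.sqrt r) • (1 : R) + c := by
  have hnorm := norm_mul_mul_sub_mul_mul_le (CFC.norm_sqrt_le_one ha ha1) hb1
    (CFC.norm_sqrt_smul_one_add_sub_sqrt_le ha hr)
  rw [Real.sq_sqrt hr] at hnorm
  have hsa (x : R) : IsSelfAdjoint (CFC.sqrt x * b * CFC.sqrt x) :=
    hb.conjugate_self (IsSelfAdjoint.of_nonneg (CFC.sqrt_nonneg x))
  have hle := ((hsa (r • (1 : R) + a)).sub (hsa a)).le_algebraMap_norm_self.trans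
    (algebraMap_mono R hnorm)
  rw [Algebra.algebraMap_eq_smul_one] at hle
  exact (sub_le_iff_le_add.1 hle).trans (by gcongr)

/-- For effects `A, B, C` on a complex Hilbert space `H` and `λ > 0`: if
`A^{1/2} B A^{1/2} ≤ C`, then
`(λI + A)^{1/2} B (λI + A)^{1/2} ≤ (λ + 2√λ)·I + C`. -/
theorem sqrt_mul_sqrt_perturb_le
    {H : Type*} [NormedAddCommGroup H] [InnerProductSpace ℂ H] [CompleteSpace H]
    (A B C : H →L[ℂ] H) (hA : 0 ≤ A ∧ A ≤ 1) (hB : 0 ≤ B ∧ B ≤ 1) (hC : 0 ≤ C ∧ C ≤ 1)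
    (lam : ℝ) (hlam : 0 < lam)
    (h : CFC.sqrt A * B * CFC.sqrt A ≤ C) :
    CFC.sqrt (lam • (1 : H →L[ℂ] H) + A) * B * CFC.sqrt (lam • (1 : H →L[ℂ] H) + A) ≤
      (lam + 2 * Real.sqrt lam) • (1 : H →L[ℂ] H) + C := by
  exact CFC.sqrt_mul_sqrt_perturb_le hA.1
    ((CStarAlgebra.norm_le_one_iff_of_nonneg A hA.1).2 hA.2) (IsSelfAdjoint.of_nonneg hB.1)
    ((CStarAlgebra.norm_le_one_iff_of_nonneg B hB.1).2 hB.2) hlam.le h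
end

section
/- Let H be a complex Hilbert space and let (A_α), (B_α) be nets in E(H) with A, B ∈ E(H). If A_α → A and B_α → B in the strong operator topology (i.e. ‖(A_α − A)x‖ → 0 and ‖(B_α − B)x‖ → 0 for every x ∈ H), then A_α^{1/2} B_α A_α^{1/2} → A^{1/2} B A^{1/2} in the strong operator topology; that is, the sequential product A ∘ B = A^{1/2} B A^{1/2} on E(H) is jointly continuous with respect to the strong operator topology. -/
set_option synthInstance.maxHeartbeats 1000000
set_option maxHeartbeats 1000000

open Filter Topology

section StrongOperatorTopology

variable {H ι : Type*} [NormedAddCommGroup H] [InnerProductSpace ℂ H] {l : Filter ι}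

/-- Multiplication is jointly continuous for pointwise convergence when the left factors are
uniformly bounded. -/
theorem tendsto_mul_apply_of_norm_le {S T : ι → H →L[ℂ] H} {S₀ T₀ : H →L[ℂ] H} {C : ℝ}
    (hC : ∀ i, ‖S i‖ ≤ C) (hS : ∀ x, Tendsto (fun i => S i x) l (𝓝 (S₀ x)))
    (hT : ∀ x, Tendsto (fun i => T i x) l (𝓝 (T₀ x))) (x : H) :
    Tendsto (fun i => (S i * T i) x) l (𝓝 ((S₀ * T₀) x)) := by
  have h₀ : Tendsto (fun i => S i (T i x - T₀ x)) l (𝓝 0) := by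
    refine squeeze_zero_norm (fun i => (S i).le_of_opNorm_le (hC i) _) ?_
    simpa using (tendsto_iff_norm_sub_tendsto_zero.1 (hT x)).const_mul C
  simpa using h₀.add (hS (T₀ x))

theorem tendsto_aeval_apply_of_norm_le_one {T : ι → H →L[ℂ] H} {T₀ : H →L[ℂ] H}
    (hT₁ : ∀ i, ‖T i‖ ≤ 1) (hT : ∀ x, Tendsto (fun i => T i x) l (𝓝 (T₀ x)))
    (p : Polynomial ℝ) (x : H) :
    Tendsto (fun i => Polynomial.aeval (T i) p x) l (𝓝 (Polynomial.aeval T₀ p x)) := by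
  have hpow (n : ℕ) : ∀ x, Tendsto (fun i => (T i ^ n) x) l (𝓝 ((T₀ ^ n) x)) := by
    induction n with
    | zero => simp [tendsto_const_nhds]
    | succ n ih =>
      simp only [pow_succ']
      exact tendsto_mul_apply_of_norm_le hT₁ hT ih
  simp only [Polynomial.aeval_eq_sum_range, sum_apply,
    smul_apply]
  exact tendsto_finsetSum _ fun n _ => (hpow n x).const_smul _

variable [CompleteSpace H]

theorem spectrum_subset_Icc_of_nonneg_of_le_one {T : H →L[ℂ] H} (h₀ : 0 ≤ T) (h₁ : T ≤ 1) :
    spectrum ℝ T ⊆ Set.Icc 0 1 := fun t ht =>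
  ⟨spectrum_nonneg_of_nonneg h₀ ht, (CFC.le_one_iff (R := ℝ) T).1 h₁ t ht⟩

/-- The continuous functional calculus on effects is strongly continuous. -/
theorem tendsto_cfc_apply_of_le_one {T : ι → H →L[ℂ] H} {T₀ : H →L[ℂ] H}
    (hT : ∀ i, 0 ≤ T i ∧ T i ≤ 1) (hT₀ : 0 ≤ T₀ ∧ T₀ ≤ 1)
    (hlim : ∀ x, Tendsto (fun i => T i x) l (𝓝 (T₀ x)))
    {f : ℝ → ℝ} (hf : ContinuousOn f (Set.Icc 0 1)) (x : H) :
    Tendsto (fun i => cfc f (T i) x) l (𝓝 (cfc f T₀ x)) := by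
  refine Metric.tendsto_nhds.2 fun ε hε => ?_
  obtain ⟨δ, hδ, hδε⟩ : ∃ δ > 0, δ * ‖x‖ < ε / 3 :=
    ⟨ε / 3 / (‖x‖ + 1), by positivity, by
      rw [div_mul_eq_mul_div, div_lt_iff₀ (by positivity)]
      nlinarith⟩
  obtain ⟨p, hp⟩ := exists_polynomial_near_of_continuousOn 0 1 f hf δ hδ
  have happrox {S : H →L[ℂ] H} (hS : 0 ≤ S ∧ S ≤ 1) :
      ‖cfc f S x - Polynomial.aeval S p x‖ < ε / 3 := by
    have hsp := spectrum_subset_Icc_of_nonneg_of_le_one hS.1 hS.2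
    have hnorm : ‖cfc f S - Polynomial.aeval S p‖ ≤ δ := by
      rw [← cfc_polynomial p S (IsSelfAdjoint.of_nonneg hS.1),
        ← cfc_sub _ _ S (hf.mono hsp) p.continuous.continuousOn]
      refine norm_cfc_le hδ.le fun t ht => ?_
      rw [Real.norm_eq_abs, abs_sub_comm]
      exact (hp t (hsp ht)).le
    exact ((cfc f S - Polynomial.aeval S p).le_of_opNorm_le hnorm x).trans_lt hδε
  have hpoly := tendsto_aeval_apply_of_norm_le_one
    (fun i => (CStarAlgebra.norm_le_one_iff_of_nonneg (T i) (hT i).1).2 (hT i).2) hlim p x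
  filter_upwards [Metric.tendsto_nhds.1 hpoly (ε / 3) (by positivity)] with i hi
  have h₁ := happrox (hT i)
  have h₂ := happrox hT₀
  rw [← dist_eq_norm] at h₁ h₂
  rw [dist_comm] at h₂
  linarith [dist_triangle4 (cfc f (T i) x) (Polynomial.aeval (T i) p x)
    (Polynomial.aeval T₀ p x) (cfc f T₀ x)]

theorem sqrt_eq_cfc_real_sqrt {T : H →L[ℂ] H} (hT : 0 ≤ T) :
    CFC.sqrt T = cfc Real.sqrt T := by
  rw [CFC.sqrt_eq_real_sqrt T hT, cfcₙ_eq_cfc]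

theorem norm_sqrt_le_one {T : H →L[ℂ] H} (h₀ : 0 ≤ T) (h₁ : T ≤ 1) : ‖CFC.sqrt T‖ ≤ 1 := by
  rw [sqrt_eq_cfc_real_sqrt h₀]
  refine norm_cfc_le zero_le_one fun t ht => ?_
  rw [Real.norm_of_nonneg (Real.sqrt_nonneg t), Real.sqrt_le_one]
  exact (spectrum_subset_Icc_of_nonneg_of_le_one h₀ h₁ ht).2

end StrongOperatorTopology

/-- The sequential product `A ∘ B = A^{1/2} B A^{1/2}` on the quantum effects of a
complex Hilbert space `H` is jointly continuous with respect to the strong operator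
topology: if `‖(A_α − A)x‖ → 0` and `‖(B_α − B)x‖ → 0` for every `x ∈ H`, then
`‖(A_α^{1/2} B_α A_α^{1/2} − A^{1/2} B A^{1/2})x‖ → 0` for every `x ∈ H`. -/
theorem sequentialProduct_jointly_continuous_SOT
    {H : Type*} [NormedAddCommGroup H] [InnerProductSpace ℂ H] [CompleteSpace H]
    {ι : Type*} [Preorder ι] [Nonempty ι] [IsDirected ι (· ≤ ·)] {l : Filter ι}
    (A B : ι → H →L[ℂ] H) (A₀ B₀ : H →L[ℂ] H)
    (hA : ∀ α, 0 ≤ A α ∧ A α ≤ 1) (hB : ∀ α, 0 ≤ B α ∧ B α ≤ 1)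
    (hA₀ : 0 ≤ A₀ ∧ A₀ ≤ 1) (hB₀ : 0 ≤ B₀ ∧ B₀ ≤ 1)
    (hAconv : ∀ x : H, Filter.Tendsto (fun α => ‖(A α - A₀) x‖) l (nhds 0))
    (hBconv : ∀ x : H, Filter.Tendsto (fun α => ‖(B α - B₀) x‖) l (nhds 0)) :
    ∀ x : H,
      Filter.Tendsto
        (fun α => ‖(CFC.sqrt (A α) * B α * CFC.sqrt (A α) -
          CFC.sqrt A₀ * B₀ * CFC.sqrt A₀) x‖) l (nhds 0) := by
  have hlim {T : ι → H →L[ℂ] H} {T₀ : H →L[ℂ] H}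
      (h : ∀ x, Filter.Tendsto (fun α => ‖(T α - T₀) x‖) l (nhds 0)) (x : H) :
      Filter.Tendsto (fun α => T α x) l (nhds (T₀ x)) :=
    tendsto_iff_norm_sub_tendsto_zero.2 (h x)
  have hsqrt (x : H) :
      Filter.Tendsto (fun α => CFC.sqrt (A α) x) l (nhds (CFC.sqrt A₀ x)) := by
    simp only [sqrt_eq_cfc_real_sqrt (hA _).1, sqrt_eq_cfc_real_sqrt hA₀.1]
    exact tendsto_cfc_apply_of_le_one hA hA₀ (hlim hAconv) Real.continuous_sqrt.continuousOn x
  have hsqrt_norm (α : ι) : ‖CFC.sqrt (A α)‖ ≤ 1 := norm_sqrt_le_one (hA α).1 (hA α).2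
  have hB_norm (α : ι) : ‖B α‖ ≤ 1 :=
    (CStarAlgebra.norm_le_one_iff_of_nonneg (B α) (hB α).1).2 (hB α).2
  intro x
  simp only [mul_assoc]
  exact tendsto_iff_norm_sub_tendsto_zero.1 <| tendsto_mul_apply_of_norm_le hsqrt_norm hsqrt
    (tendsto_mul_apply_of_norm_le hB_norm (hlim hBconv) hsqrt) x
end
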